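/- Let 𝓜 be a loc-lattice of subsets of a set X which well separates X. Then there exists a linear ordering ≤ of X such that every M ∈ 𝓜 is a convex subset of (X, ≤) and for all A, B ∈ 𝓜, the join A ∨ B equals the smallest convex subset of (X, ≤) containing A ∪ B; hence (𝓜, ⊆) is a sublattice of the lattice of all convex subsets of (X, ≤). -/

import Mathlib

universe u

/-- `(xyz)_𝓜` : every member of `𝓜` containing `x` and `z` also contains `y`. -/
def MBtw {X : Type u} (𝓜 : Set (Set X)) (x y z : X) : Prop :=
  ∀ M ∈ 𝓜, x ∈ M → z ∈ M → y ∈ M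

/-- Convexity of a set with respect to a relation `le`. -/
def RelConvex {X : Type u} (le : X → X → Prop) (S : Set X) : Prop :=
  ∀ a b c : X, a ∈ S → c ∈ S → le a b → le b c → b ∈ S

/-- A loc-lattice of subsets of `X`: `𝓜` is a lattice under inclusion whose joins are
given by `sup` and whose meets are intersections, satisfying conditions (1)-(4) of
Definition 2.1 of the paper. -/
structure SetLocLattice {X : Type u} (𝓜 : Set (Set X)) (sup : Set X → Set X → Set X) :
    Prop where
  sup_mem : ∀ A ∈ 𝓜, ∀ B ∈ 𝓜, sup A B ∈ 𝓜
  subset_sup_left : ∀ A ∈ 𝓜, ∀ B ∈ 𝓜, A ⊆ sup A B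
  subset_sup_right : ∀ A ∈ 𝓜, ∀ B ∈ 𝓜, B ⊆ sup A B
  sup_least : ∀ A ∈ 𝓜, ∀ B ∈ 𝓜, ∀ C ∈ 𝓜, A ⊆ C → B ⊆ C → sup A B ⊆ C
  inter_mem : ∀ A ∈ 𝓜, ∀ B ∈ 𝓜, A ∩ B ∈ 𝓜
  sup_eq_union : ∀ A ∈ 𝓜, ∀ B ∈ 𝓜, (A ∩ B).Nonempty → sup A B = A ∪ B
  trichotomy : ∀ A ∈ 𝓜, ∀ B ∈ 𝓜, ∀ C ∈ 𝓜,
    A ⊆ sup B C ∨ B ⊆ sup A C ∨ C ⊆ sup A B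
  incomp : ∀ A ∈ 𝓜, ∀ B ∈ 𝓜, ∀ C ∈ 𝓜,
    (¬ A ⊆ B ∧ ¬ B ⊆ A) → (¬ A ⊆ C ∧ ¬ C ⊆ A) → (¬ B ⊆ C ∧ ¬ C ⊆ B) →
    B ⊆ sup A C → B = sup A B ∩ sup C B

/-- `𝓜` separates the points of `X`. -/
def SeparatesPoints {X : Type u} (𝓜 : Set (Set X)) : Prop :=
  ∀ x y : X, x ≠ y → ∃ M ∈ 𝓜, (x ∈ M ∧ y ∉ M) ∨ (x ∉ M ∧ y ∈ M)

/-- `𝓜` well separates `X`. -/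
def WellSeparates {X : Type u} (𝓜 : Set (Set X)) : Prop :=
  SeparatesPoints 𝓜 ∧ ∀ M ∈ 𝓜, ∀ x : X, x ∉ M → ∃ N ∈ 𝓜, x ∈ N ∧ ¬ N ⊆ M

/-- Two points are completely separated by `𝓜`. -/
def CompSeparated {X : Type u} (𝓜 : Set (Set X)) (x y : X) : Prop :=
  ∃ A ∈ 𝓜, ∃ B ∈ 𝓜, x ∈ A ∧ y ∉ A ∧ y ∈ B ∧ x ∉ B

/-- `𝓜` completely separates `X`. -/
def CompletelySeparates {X : Type u} (𝓜 : Set (Set X)) : Prop :=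
  ∀ x y : X, x ≠ y → CompSeparated 𝓜 x y

/-- The double cover of the graph of a symmetric irreflexive relation `inc` with edges signed
by `c`: the sign of an edge tells whether it changes the sheet. -/
def signedCover {X : Type u} (inc : X → X → Prop) (c : X → X → Bool)
    (hirr : ∀ x, ¬ inc x x) (hsymm : ∀ x y, inc x y → inc y x)
    (hc : ∀ x y, c x y = c y x) : SimpleGraph (X × Bool) where
  Adj a b := inc a.1 b.1 ∧ (a.2 ^^ b.2) = c a.1 b.1
  symm := ⟨fun a b h => ⟨hsymm _ _ h.1, by rw [hc, Bool.xor_comm]; exact h.2⟩⟩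
  loopless := ⟨fun a h => hirr _ h.1⟩

section SignedCover

variable {X : Type u} {inc lt : X → X → Prop} {c : X → X → Bool}
  {hirr : ∀ x, ¬ inc x x} {hsymm : ∀ x y, inc x y → inc y x} {hc : ∀ x y, c x y = c y x}

theorem signedCover_adj {a b : X × Bool} : (signedCover inc c hirr hsymm hc).Adj a b ↔
    inc a.1 b.1 ∧ (a.2 ^^ b.2) = c a.1 b.1 := Iff.rfl

/-- A walk of length at least two without shortcuts over two or three consecutive edges is
monotone. -/
theorem signedCover_walk_lt (hlt : ∀ x y z, lt x y → lt y z → lt x z)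
    (htri : ∀ x y, x = y ∨ inc x y ∨ lt x y ∨ lt y x)
    (hinc : ∀ x y, inc x y → ¬ lt x y)
    (hsq : ∀ x y z w, lt x z → lt y w → inc x y → inc y z → inc z w → inc x w →
      (c x y ^^ c y z ^^ c z w) = c x w)
    (v : ℕ → X × Bool) (n : ℕ)
    (hadj : ∀ i, i < n → (signedCover inc c hirr hsymm hc).Adj (v i) (v (i + 1)))
    (h2 : ∀ i, i + 2 ≤ n → lt (v i).1 (v (i + 2)).1 ∨ lt (v (i + 2)).1 (v i).1)
    (h3 : ∀ i, i + 3 ≤ n → ¬ (signedCover inc c hirr hsymm hc).Adj (v i) (v (i + 3)))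
    (h0 : lt (v 0).1 (v 2).1) (hn : 2 ≤ n) : lt (v 0).1 (v n).1 := by
  have key : ∀ i, i + 3 ≤ n → lt (v i).1 (v (i + 2)).1 →
      lt (v (i + 1)).1 (v (i + 3)).1 ∧ lt (v i).1 (v (i + 3)).1 := by
    intro i hi hl
    have a1 := hadj i (by omega)
    have a2 := hadj (i + 1) (by omega)
    have a3 := hadj (i + 2) (by omega)
    have n3 := h3 i hi
    simp only [signedCover_adj, add_assoc, Nat.reduceAdd] at a1 a2 a3 n3
    obtain ⟨i1, c1⟩ := a1
    obtain ⟨i2, c2⟩ := a2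
    obtain ⟨i3, c3⟩ := a3
    have no_inc_up : lt (v (i + 1)).1 (v (i + 3)).1 → ¬ inc (v i).1 (v (i + 3)).1 := by
      intro hb hi4
      refine n3 ⟨hi4, ?_⟩
      rw [← hsq _ _ _ _ hl hb i1 i2 i3 hi4, ← c1, ← c2, ← c3]
      generalize (v i).2 = p, (v (i + 1)).2 = q, (v (i + 2)).2 = r, (v (i + 3)).2 = s
      revert p q r s; decide
    have no_inc_down : lt (v (i + 3)).1 (v (i + 1)).1 → ¬ inc (v i).1 (v (i + 3)).1 := by
      intro hb hi4
      refine n3 ⟨hi4, ?_⟩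
      have := hsq _ _ _ _ hl hb hi4 (hsymm _ _ i3) (hsymm _ _ i2) i1
      rw [hc (v (i + 3)).1, hc (v (i + 2)).1 (v (i + 1)).1, ← c1, ← c2, ← c3] at this
      revert this
      generalize c (v i).1 (v (i + 3)).1 = e
      generalize (v i).2 = p, (v (i + 1)).2 = q, (v (i + 2)).2 = r, (v (i + 3)).2 = s
      revert p q r s e; decide
    have hup : lt (v (i + 1)).1 (v (i + 3)).1 := by
      rcases h2 (i + 1) (by omega) with hb | hb
      · exact hb
      · exfalso
        change lt (v (i + 3)).1 (v (i + 1)).1 at hb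
        rcases htri (v i).1 (v (i + 3)).1 with e | e | e | e
        · rw [← e] at hb; exact hinc _ _ i1 hb
        · exact no_inc_down hb e
        · exact hinc _ _ i1 (hlt _ _ _ e hb)
        · exact hinc _ _ (hsymm _ _ i3) (hlt _ _ _ e hl)
    refine ⟨hup, ?_⟩
    rcases htri (v i).1 (v (i + 3)).1 with e | e | e | e
    · rw [← e] at hup; exact absurd hup (hinc _ _ (hsymm _ _ i1))
    · exact absurd e (no_inc_up hup)
    · exact e
    · exact absurd (hlt _ _ _ e hl) (hinc _ _ (hsymm _ _ i3))
  have mono : ∀ i, i + 2 ≤ n → lt (v i).1 (v (i + 2)).1 := by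
    intro i
    induction i with
    | zero => intro _; exact h0
    | succ i ih => intro hi; exact (key i (by omega) (ih (by omega))).1
  have main : ∀ k, 2 ≤ k → k ≤ n → lt (v 0).1 (v k).1 := by
    intro k
    induction k using Nat.strong_induction_on with
    | _ k ih =>
      intro hk hkn
      obtain rfl | rfl | hk4 : k = 2 ∨ k = 3 ∨ 4 ≤ k := by omega
      · exact h0
      · exact (key 0 (by omega) h0).2
      · obtain ⟨j, rfl⟩ := Nat.exists_eq_add_of_le hk4
        have e : 4 + j = (2 + j) + 2 := by omega
        rw [e]
        exact hlt _ _ _ (ih (2 + j) (by omega) (by omega) (by omega)) (mono _ (by omega))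
  exact main n hn le_rfl

/-- A signed incomparability graph in which triangles and monotone squares are balanced is
balanced. -/
theorem signedCover_not_reachable_flip (hlt : ∀ x y z, lt x y → lt y z → lt x z)
    (hlirr : ∀ x, ¬ lt x x)
    (htri : ∀ x y, x = y ∨ inc x y ∨ lt x y ∨ lt y x)
    (hinc : ∀ x y, inc x y → ¬ lt x y)
    (htr : ∀ x y z, inc x y → inc y z → inc x z → (c x y ^^ c y z) = c x z)
    (hsq : ∀ x y z w, lt x z → lt y w → inc x y → inc y z → inc z w → inc x w →
      (c x y ^^ c y z ^^ c z w) = c x w) (x : X) (p q : Bool)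
    (hr : (signedCover inc c hirr hsymm hc).Reachable (x, p) (x, q)) : p = q := by
  obtain ⟨w, hw⟩ := hr.exists_walk_length_eq_dist
  have hshort : ∀ i k, i + k ≤ w.length →
      ∀ r : (signedCover inc c hirr hsymm hc).Walk (w.getVert i) (w.getVert (i + k)),
        k ≤ r.length := by
    intro i k hik r
    have := (signedCover inc c hirr hsymm hc).dist_le
      (((w.take i).append r).append (w.drop (i + k)))
    simp only [SimpleGraph.Walk.length_append, SimpleGraph.Walk.take_length,
      SimpleGraph.Walk.drop_length] at this
    omega
  have hadj : ∀ i, i < w.length →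
      (signedCover inc c hirr hsymm hc).Adj (w.getVert i) (w.getVert (i + 1)) :=
    fun i hi => w.adj_getVert_succ hi
  have hnadj : ∀ i k, 2 ≤ k → i + k ≤ w.length →
      ¬ (signedCover inc c hirr hsymm hc).Adj (w.getVert i) (w.getVert (i + k)) := by
    intro i k hk hik h
    have := hshort i k hik h.toWalk
    simp at this
    omega
  have h2 : ∀ i, i + 2 ≤ w.length → lt (w.getVert i).1 (w.getVert (i + 2)).1 ∨
      lt (w.getVert (i + 2)).1 (w.getVert i).1 := by
    intro i hi
    have a1 := hadj i (by omega)
    have a2 := hadj (i + 1) (by omega)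
    have n2 := hnadj i 2 le_rfl hi
    have hne : w.getVert i ≠ w.getVert (i + 2) := by
      intro e
      have := hshort i 2 hi (SimpleGraph.Walk.nil.copy rfl e)
      simp at this
    simp only [signedCover_adj, add_assoc, Nat.reduceAdd] at a1 a2 n2
    obtain ⟨i1, c1⟩ := a1
    obtain ⟨i2, c2⟩ := a2
    rcases htri (w.getVert i).1 (w.getVert (i + 2)).1 with e | e | e
    · refine absurd (Prod.ext e ?_) hne
      rw [← e, hc, ← c1] at c2
      revert c2
      generalize (w.getVert i).2 = p, (w.getVert (i + 1)).2 = q, (w.getVert (i + 2)).2 = r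
      revert p q r; decide
    · refine absurd ⟨e, ?_⟩ n2
      rw [← htr _ _ _ i1 i2 e, ← c1, ← c2]
      generalize (w.getVert i).2 = p, (w.getVert (i + 1)).2 = q, (w.getVert (i + 2)).2 = r
      revert p q r; decide
    · exact e
  have hlen : w.length < 2 := by
    by_contra hn
    push Not at hn
    rcases h2 0 (by omega) with h0 | h0
    · have := signedCover_walk_lt hlt htri hinc hsq w.getVert w.length hadj h2
        (fun i hi => hnadj i 3 (by omega) hi) h0 hn
      rw [w.getVert_zero, w.getVert_length] at this
      exact hlirr _ this
    · have := signedCover_walk_lt (lt := fun x y => lt y x) (fun x y z h h' => hlt _ _ _ h' h)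
        (fun x y => by have := htri x y; tauto) (fun x y h => hinc _ _ (hsymm _ _ h))
        (fun x y z t h h' i1 i2 i3 i4 => by
          have := hsq z t x y h h' i3 (hsymm _ _ i4) i1 (hsymm _ _ i2)
          rw [hc t x, hc z y] at this
          revert this
          generalize c x y = e1, c y z = e2, c z t = e3, c x t = e4
          revert e1 e2 e3 e4; decide) w.getVert w.length hadj
        (fun i hi => (h2 i hi).symm) (fun i hi => hnadj i 3 (by omega) hi) h0 hn
      rw [w.getVert_zero, w.getVert_length] at this
      exact hlirr _ this
  obtain hl | hl : w.length = 0 ∨ w.length = 1 := by omega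
  · exact (Prod.ext_iff.1 (SimpleGraph.Walk.eq_of_length_eq_zero hl)).2
  · exact absurd (SimpleGraph.Walk.adj_of_length_eq_one hl).1 (hirr x)

/-- A balanced signed graph is switching equivalent to the trivially signed one. -/
theorem exists_switching (hirr : ∀ x, ¬ inc x x) (hsymm : ∀ x y, inc x y → inc y x)
    (hc : ∀ x y, c x y = c y x)
    (hbal : ∀ x p q, (signedCover inc c hirr hsymm hc).Reachable (x, p) (x, q) → p = q) :
    ∃ σ : X → Bool, ∀ x y, inc x y → (σ x ^^ σ y) = c x y := by
  let G := signedCover inc c hirr hsymm hc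
  have flip : ∀ x y p q, G.Reachable (x, p) (y, q) → G.Reachable (x, !p) (y, !q) := by
    intro x y p q hr
    refine hr.map (G' := G) (f := ⟨fun v => (v.1, !v.2), ?_⟩)
    rintro ⟨a, p⟩ ⟨b, q⟩ ⟨h1, h2⟩
    exact ⟨h1, by simpa using h2⟩
  let S : Setoid X :=
    { r := fun x y => ∃ q, G.Reachable (x, false) (y, q)
      iseqv :=
        { refl := fun x => ⟨false, .refl _⟩
          symm := by
            rintro x y ⟨q, hq⟩
            cases q
            · exact ⟨_, hq.symm⟩
            · exact ⟨_, flip _ _ _ _ hq.symm⟩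
          trans := by
            rintro x y z ⟨p, hp⟩ ⟨q, hq⟩
            cases p
            · exact ⟨_, hp.trans hq⟩
            · exact ⟨_, hp.trans (flip _ _ _ _ hq)⟩ } }
  let r : X → X := fun x => (Quotient.mk S x).out
  have hr : ∀ x, ∃ q, G.Reachable (r x, false) (x, q) := fun x => Quotient.mk_out (s := S) x
  choose σ hσ using hr
  refine ⟨σ, fun x y hxy => ?_⟩
  have hadj : G.Adj (x, σ x) (y, σ x ^^ c x y) := ⟨hxy, by simp⟩
  have hrxy : r x = r y := by
    have : Quotient.mk S x = Quotient.mk S y := by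
      refine Quotient.sound ?_
      cases h : σ x
      · exact ⟨_, h ▸ hadj.reachable⟩
      · exact ⟨_, by simpa [h] using flip _ _ _ _ hadj.reachable⟩
    simp only [r, this]
  have h1 := (hσ x).trans hadj.reachable
  rw [hrxy] at h1
  rw [hbal _ _ _ ((hσ y).symm.trans h1)]
  simp

end SignedCover

namespace SetLocLattice

variable {X : Type u} {𝓜 : Set (Set X)} {sup : Set X → Set X → Set X}

theorem sup_comm (h : SetLocLattice 𝓜 sup) {A B : Set X} (hA : A ∈ 𝓜) (hB : B ∈ 𝓜) :
    sup A B = sup B A :=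
  Set.Subset.antisymm
    (h.sup_least _ hA _ hB _ (h.sup_mem _ hB _ hA) (h.subset_sup_right _ hB _ hA)
      (h.subset_sup_left _ hB _ hA))
    (h.sup_least _ hB _ hA _ (h.sup_mem _ hA _ hB) (h.subset_sup_right _ hA _ hB)
      (h.subset_sup_left _ hA _ hB))

theorem sup_eq_right (h : SetLocLattice 𝓜 sup) {A B : Set X} (hA : A ∈ 𝓜) (hB : B ∈ 𝓜)
    (hAB : A ⊆ B) : sup A B = B :=
  Set.Subset.antisymm (h.sup_least _ hA _ hB _ hB hAB subset_rfl)
    (h.subset_sup_right _ hA _ hB)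

theorem sup_eq_left (h : SetLocLattice 𝓜 sup) {A B : Set X} (hA : A ∈ 𝓜) (hB : B ∈ 𝓜)
    (hBA : B ⊆ A) : sup A B = A := by
  rw [h.sup_comm hA hB, h.sup_eq_right hB hA hBA]

theorem notMem_sup_of_mem (h : SetLocLattice 𝓜 sup) {A B : Set X} (hA : A ∈ 𝓜) (hB : B ∈ 𝓜)
    {p y : X} (hpA : p ∈ A) (hpB : p ∈ B) (hyA : y ∉ A) (hyB : y ∉ B) : y ∉ sup A B := by
  rw [h.sup_eq_union _ hA _ hB ⟨p, hpA, hpB⟩]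
  exact fun hy => hy.elim hyA hyB

/-- A point in a nontrivial join that lies in neither part rules out comparability. -/
theorem incomparable_of_mem_sup (h : SetLocLattice 𝓜 sup) {A B : Set X} (hA : A ∈ 𝓜)
    (hB : B ∈ 𝓜) {y : X} (hyA : y ∉ A) (hyB : y ∉ B) (hy : y ∈ sup A B) :
    ¬ A ⊆ B ∧ ¬ B ⊆ A :=
  ⟨fun hs => hyB (h.sup_eq_right hA hB hs ▸ hy), fun hs => hyA (h.sup_eq_left hA hB hs ▸ hy)⟩

theorem notMem_sup_trans (h : SetLocLattice 𝓜 sup) {A B C : Set X} (hA : A ∈ 𝓜) (hB : B ∈ 𝓜)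
    (hC : C ∈ 𝓜) (hne : B.Nonempty) {y : X} (hAB : y ∉ sup A B) (hBC : y ∉ sup B C) :
    y ∉ sup A C := by
  obtain ⟨p, hp⟩ := hne
  have hABm := h.sup_mem _ hA _ hB
  have hBCm := h.sup_mem _ hB _ hC
  have := h.notMem_sup_of_mem hABm hBCm (h.subset_sup_right _ hA _ hB hp)
    (h.subset_sup_left _ hB _ hC hp) hAB hBC
  refine fun hy => this (h.sup_least _ hA _ hC _ (h.sup_mem _ hABm _ hBCm) ?_ ?_ hy)
  · exact (h.subset_sup_left _ hA _ hB).trans (h.subset_sup_left _ hABm _ hBCm)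
  · exact (h.subset_sup_right _ hB _ hC).trans (h.subset_sup_right _ hABm _ hBCm)

/-- A set in the join of two others separates every point lying in both joins with it. -/
theorem mem_of_mem_sup_of_subset (h : SetLocLattice 𝓜 sup) {A B C : Set X} (hA : A ∈ 𝓜)
    (hB : B ∈ 𝓜) (hC : C ∈ 𝓜) (hAB : ¬ A ⊆ B ∧ ¬ B ⊆ A) (hAC : ¬ A ⊆ C ∧ ¬ C ⊆ A)
    (hBC : ¬ B ⊆ C ∧ ¬ C ⊆ B) (hs : B ⊆ sup A C) {y : X} (h1 : y ∈ sup A B)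
    (h2 : y ∈ sup B C) : y ∈ B := by
  rw [h.incomp _ hA _ hB _ hC hAB hAC hBC hs]
  exact ⟨h1, h.sup_comm hB hC ▸ h2⟩

/-- A point avoided by three sets is not in all three of their pairwise joins. -/
theorem not_mem_three_sups (h : SetLocLattice 𝓜 sup) {A B C : Set X} (hA : A ∈ 𝓜)
    (hB : B ∈ 𝓜) (hC : C ∈ 𝓜) {y : X} (hyA : y ∉ A) (hyB : y ∉ B) (hyC : y ∉ C)
    (hAB : y ∈ sup A B) (hBC : y ∈ sup B C) (hAC : y ∈ sup A C) : False := by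
  have iAB := h.incomparable_of_mem_sup hA hB hyA hyB hAB
  have iAC := h.incomparable_of_mem_sup hA hC hyA hyC hAC
  have iBC := h.incomparable_of_mem_sup hB hC hyB hyC hBC
  have hBA : y ∈ sup B A := h.sup_comm hA hB ▸ hAB
  have hCB : y ∈ sup C B := h.sup_comm hB hC ▸ hBC
  rcases h.trichotomy _ hA _ hB _ hC with hs | hs | hs
  · exact hyA (h.mem_of_mem_sup_of_subset hB hA hC iAB.symm iBC iAC hs hBA hAC)
  · exact hyB (h.mem_of_mem_sup_of_subset hA hB hC iAB iAC iBC hs hAB hBC)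
  · exact hyC (h.mem_of_mem_sup_of_subset hA hC hB iAC iAB iBC.symm hs hAC hCB)

/-- Of two mutually separated points, at most one lies between the other and a third set. -/
theorem not_mem_sup_and_mem_sup (h : SetLocLattice 𝓜 sup) {A B C : Set X} (hA : A ∈ 𝓜)
    (hB : B ∈ 𝓜) (hC : C ∈ 𝓜) {x y : X} (hxA : x ∈ A) (hyA : y ∉ A) (hyB : y ∈ B)
    (hxB : x ∉ B) (hxC : x ∉ C) (hyC : y ∉ C) (hx : x ∈ sup B C) (hy : y ∈ sup A C) :
    False := by
  have hBCm := h.sup_mem _ hB _ hC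
  have hDm := h.inter_mem _ hA _ hBCm
  have iAC := h.incomparable_of_mem_sup hA hC hyA hyC hy
  have iBC := h.incomparable_of_mem_sup hB hC hxB hxC hx
  have hyD : y ∉ A ∩ sup B C := fun hD => hyA hD.1
  have hDC : y ∈ sup (A ∩ sup B C) C := by
    by_contra hn
    refine h.notMem_sup_trans hA hDm hC ⟨x, hxA, hx⟩ ?_ hn hy
    exact h.notMem_sup_of_mem hA hDm hxA ⟨hxA, hx⟩ hyA hyD
  exact hyD (h.mem_of_mem_sup_of_subset hB hDm hC
    ⟨fun hs => hyD (hs hyB), fun hs => hxB (hs ⟨hxA, hx⟩)⟩ iBC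
    ⟨fun hs => hxC (hs ⟨hxA, hx⟩), fun hs => iAC.2 fun z hz => (hs hz).1⟩
    Set.inter_subset_right (h.subset_sup_left _ hB _ hDm hyB) hDC)

end SetLocLattice

section Sides

variable {X : Type u} {𝓜 : Set (Set X)} {sup : Set X → Set X → Set X} {f : X → Set X → Bool}

/-- `A` is a nonempty member of `𝓜` that avoids `y`. -/
def Avoids (𝓜 : Set (Set X)) (y : X) (A : Set X) : Prop := A ∈ 𝓜 ∧ A.Nonempty ∧ y ∉ A

/-- `f y` tells apart the two sides of `y`: members of `𝓜` avoiding `y` are on the same side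
of `y` exactly when their join avoids `y`. -/
def SideColoring (𝓜 : Set (Set X)) (sup : Set X → Set X → Set X) (f : X → Set X → Bool) :
    Prop :=
  ∀ y A B, Avoids 𝓜 y A → Avoids 𝓜 y B → (f y A = f y B ↔ y ∉ sup A B)

/-- `W` is on the side of `y` on which `x` is: it contains `x`, or `x` lies between `y`
and `W`. -/
def Witness (𝓜 : Set (Set X)) (sup : Set X → Set X → Set X) (y x : X) (W : Set X) : Prop :=
  W ∈ 𝓜 ∧ y ∉ W ∧ (x ∈ W ∨ (x ∉ W ∧ ∃ A ∈ 𝓜, y ∈ A ∧ x ∉ A ∧ x ∈ sup A W))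

/-- Some member of `𝓜` determines the side of `y` on which `x` is. -/
def Sees (𝓜 : Set (Set X)) (sup : Set X → Set X → Set X) (y x : X) : Prop :=
  ∃ W, Witness 𝓜 sup y x W

open Classical in
/-- The side of `y` on which `x` is. -/
noncomputable def side (𝓜 : Set (Set X)) (sup : Set X → Set X → Set X)
    (f : X → Set X → Bool) (y x : X) : Bool :=
  if hs : Sees 𝓜 sup y x then f y hs.choose else false

theorem SetLocLattice.exists_sideColoring (h : SetLocLattice 𝓜 sup) :
    ∃ f, SideColoring 𝓜 sup f := by
  classical
  have : ∀ y, ∃ g : Set X → Bool, ∀ A B, Avoids 𝓜 y A → Avoids 𝓜 y B →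
      (g A = g B ↔ y ∉ sup A B) := by
    intro y
    by_cases hne : ∃ C, Avoids 𝓜 y C
    · obtain ⟨C, hC, hCne, hyC⟩ := hne
      refine ⟨fun A => decide (y ∈ sup A C), ?_⟩
      rintro A B ⟨hA, hAne, hyA⟩ ⟨hB, hBne, hyB⟩
      have hBC := h.sup_comm hB hC
      have hAB := h.sup_comm hA hB
      have h1 := h.notMem_sup_trans (y := y) hA hC hB hCne
      have h2 := h.notMem_sup_trans (y := y) hA hB hC hBne
      have h3 := h.notMem_sup_trans (y := y) hB hA hC hAne
      have h4 := h.not_mem_three_sups hA hB hC hyA hyB hyC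
      rw [decide_eq_decide]
      grind
    · exact ⟨fun _ => false, fun A _ hA => absurd ⟨A, hA⟩ hne⟩
  choose f hf using this
  exact ⟨f, hf⟩

theorem Witness.avoids (h : SetLocLattice 𝓜 sup) {x y : X} {W : Set X}
    (hW : Witness 𝓜 sup y x W) : Avoids 𝓜 y W := by
  obtain ⟨hm, hy, hx | ⟨hx, A, hA, -, hxA, hs⟩⟩ := hW
  · exact ⟨hm, ⟨x, hx⟩, hy⟩
  · refine ⟨hm, Set.nonempty_iff_ne_empty.2 fun he => ?_, hy⟩
    exact (h.incomparable_of_mem_sup hA hm hxA hx hs).2 (he ▸ Set.empty_subset _)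

theorem Sees.ne {x y : X} (hs : Sees 𝓜 sup y x) : y ≠ x := by
  rintro rfl
  obtain ⟨W, -, hy, hx | ⟨-, A, -, hyA, hxA, -⟩⟩ := hs
  · exact hy hx
  · exact hxA hyA

theorem witness_of_mem {x y : X} {A : Set X} (hA : A ∈ 𝓜) (hx : x ∈ A) (hy : y ∉ A) :
    Witness 𝓜 sup y x A := ⟨hA, hy, .inl hx⟩

/-- Two points each seen by the other. -/
def MutuallySee (𝓜 : Set (Set X)) (sup : Set X → Set X → Set X) (x y : X) : Prop :=
  Sees 𝓜 sup x y ∧ Sees 𝓜 sup y x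

theorem MutuallySee.symm {x y : X} (hs : MutuallySee 𝓜 sup x y) : MutuallySee 𝓜 sup y x :=
  ⟨hs.2, hs.1⟩

theorem exists_separating (hsep : SeparatesPoints 𝓜) {x z : X} (hxz : x ≠ z)
    (hzx : ∀ M ∈ 𝓜, z ∈ M → x ∈ M) : ∃ A ∈ 𝓜, x ∈ A ∧ z ∉ A := by
  obtain ⟨A, hA, hh | hh⟩ := hsep x z hxz
  · exact ⟨A, hA, hh⟩
  · exact absurd (hzx _ hA hh.2) hh.1

theorem sees_or_sees_of_ne (hsep : SeparatesPoints 𝓜) {x y : X} (hxy : x ≠ y) :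
    Sees 𝓜 sup x y ∨ Sees 𝓜 sup y x := by
  obtain ⟨M, hM, ⟨hx, hy⟩ | ⟨hx, hy⟩⟩ := hsep x y hxy
  · exact .inr ⟨M, witness_of_mem hM hx hy⟩
  · exact .inl ⟨M, witness_of_mem hM hy hx⟩

theorem mem_of_not_sees {x y : X} (hns : ¬ Sees 𝓜 sup x y) {M : Set X} (hM : M ∈ 𝓜)
    (hy : y ∈ M) : x ∈ M := by
  by_contra hx
  exact hns ⟨M, witness_of_mem hM hy hx⟩

/-- `σ x` tells how to read the labels of the sides of `x`, so that any two points that see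
each other agree on their order. -/
def Orients (𝓜 : Set (Set X)) (sup : Set X → Set X → Set X) (f : X → Set X → Bool)
    (σ : X → Bool) : Prop :=
  ∀ x y, MutuallySee 𝓜 sup x y →
    (σ x ^^ side 𝓜 sup f x y) ≠ (σ y ^^ side 𝓜 sup f y x)

namespace SideColoring

theorem eq_of_mem (h : SetLocLattice 𝓜 sup) (hf : SideColoring 𝓜 sup f) {A B : Set X}
    (hA : A ∈ 𝓜) (hB : B ∈ 𝓜) {p y : X} (hpA : p ∈ A) (hpB : p ∈ B) (hyA : y ∉ A)
    (hyB : y ∉ B) : f y A = f y B :=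
  (hf y A B ⟨hA, ⟨p, hpA⟩, hyA⟩ ⟨hB, ⟨p, hpB⟩, hyB⟩).2
    (h.notMem_sup_of_mem hA hB hpA hpB hyA hyB)

theorem ne_iff (hf : SideColoring 𝓜 sup f) {A B : Set X} {y : X} (hA : Avoids 𝓜 y A)
    (hB : Avoids 𝓜 y B) : f y A ≠ f y B ↔ y ∈ sup A B := by
  rw [Ne, hf y A B hA hB, not_not]

theorem sup_left (h : SetLocLattice 𝓜 sup) (hf : SideColoring 𝓜 sup f) {A B : Set X} {y : X}
    (hA : Avoids 𝓜 y A) (hB : B ∈ 𝓜) (hy : y ∉ sup A B) : f y (sup A B) = f y A := by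
  obtain ⟨hm, ⟨p, hp⟩, hyA⟩ := hA
  have := h.subset_sup_left _ hm _ hB hp
  exact hf.eq_of_mem h (h.sup_mem _ hm _ hB) hm this hp hy hyA

/-- Opposite sides of a point are disjoint. -/
theorem notMem_of_ne (h : SetLocLattice 𝓜 sup) (hf : SideColoring 𝓜 sup f) {A B : Set X}
    (hA : A ∈ 𝓜) (hB : B ∈ 𝓜) {p y : X} (hyA : y ∉ A) (hyB : y ∉ B) (hne : f y A ≠ f y B)
    (hpA : p ∈ A) : p ∉ B :=
  fun hpB => hne (hf.eq_of_mem h hA hB hpA hpB hyA hyB)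

theorem witness_of_ne (h : SetLocLattice 𝓜 sup) (hf : SideColoring 𝓜 sup f) {A W : Set X}
    {x y : X} (hA : A ∈ 𝓜) (hyA : y ∈ A) (hxA : x ∉ A) (hW : Avoids 𝓜 x W)
    (hne : f x A ≠ f x W) : Witness 𝓜 sup y x W :=
  ⟨hW.1, hf.notMem_of_ne h hA hW.1 hxA hW.2.2 hne hyA, .inr ⟨hW.2.2, A, hA, hyA, hxA,
    (hf.ne_iff ⟨hA, ⟨y, hyA⟩, hxA⟩ hW).1 hne⟩⟩

/-- A witness not containing `x` is opposite, at `x`, to every set containing `y`. -/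
theorem ne_of_witness (h : SetLocLattice 𝓜 sup) (hf : SideColoring 𝓜 sup f) {A W : Set X}
    {x y : X} (hW : Witness 𝓜 sup y x W) (hxW : x ∉ W) (hA : A ∈ 𝓜) (hyA : y ∈ A)
    (hxA : x ∉ A) : f x A ≠ f x W := by
  have hav := hW.avoids h
  obtain ⟨hm, hy, hx | ⟨-, B, hB, hyB, hxB, hs⟩⟩ := hW
  · exact absurd hx hxW
  · rw [hf.eq_of_mem h hA hB hyA hyB hxA hxB]
    exact (hf.ne_iff ⟨hB, ⟨y, hyB⟩, hxB⟩ ⟨hm, hav.2.1, hxW⟩).2 hs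

theorem eq_of_witness (h : SetLocLattice 𝓜 sup) (hf : SideColoring 𝓜 sup f) {x y : X}
    {W W' : Set X} (hW : Witness 𝓜 sup y x W) (hW' : Witness 𝓜 sup y x W') :
    f y W = f y W' := by
  have mixed : ∀ V V', Witness 𝓜 sup y x V → Witness 𝓜 sup y x V' → x ∈ V → x ∉ V' →
      f y V = f y V' := by
    intro V V' hV hV' hx hx'
    have aV := hV.avoids h
    have aV' := hV'.avoids h
    rw [hf y V V' aV aV']
    obtain ⟨-, -, hx2 | ⟨-, A, hA, hyA, hxA, hs⟩⟩ := hV'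
    · exact absurd hx2 hx'
    · exact fun hy => h.not_mem_sup_and_mem_sup hA aV.1 aV'.1 hyA hxA hx aV.2.2 aV'.2.2 hx'
        hy hs
  by_cases hx : x ∈ W <;> by_cases hx' : x ∈ W'
  · exact hf.eq_of_mem h hW.1 hW'.1 hx hx' hW.2.1 hW'.2.1
  · exact mixed _ _ hW hW' hx hx'
  · exact (mixed _ _ hW' hW hx' hx).symm
  · have aW := hW.avoids h
    have aW' := hW'.avoids h
    rw [hf y W W' aW aW']
    intro hy
    obtain ⟨A, hA, hyA, hxA⟩ : ∃ A ∈ 𝓜, y ∈ A ∧ x ∉ A := by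
      obtain ⟨-, -, hx2 | ⟨-, A, hA, hyA, hxA, -⟩⟩ := hW
      · exact absurd hx2 hx
      · exact ⟨A, hA, hyA, hxA⟩
    have n1 := hf.ne_of_witness h hW hx hA hyA hxA
    have n2 := hf.ne_of_witness h hW' hx' hA hyA hxA
    have e : f x W = f x W' := by
      revert n1 n2; generalize f x A = p, f x W = q, f x W' = r; revert p q r; decide
    have bW : Avoids 𝓜 x W := ⟨aW.1, aW.2.1, hx⟩
    have hxs := (hf x W W' bW ⟨aW'.1, aW'.2.1, hx'⟩).1 e
    have := hf.sup_left h bW aW'.1 hxs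
    refine n1 ?_
    rw [← this]
    exact hf.eq_of_mem h hA (h.sup_mem _ aW.1 _ aW'.1) hyA hy hxA hxs

theorem side_eq (h : SetLocLattice 𝓜 sup) (hf : SideColoring 𝓜 sup f) {x y : X} {W : Set X}
    (hW : Witness 𝓜 sup y x W) : side 𝓜 sup f y x = f y W := by
  have hs : Sees 𝓜 sup y x := ⟨W, hW⟩
  rw [side, dif_pos hs]
  exact hf.eq_of_witness h hs.choose_spec hW

/-- If some other point is not seen by `y`, then all members of `𝓜` avoiding `y` are on the
same side of `y`. -/
theorem eq_of_not_sees (h : SetLocLattice 𝓜 sup) (hf : SideColoring 𝓜 sup f)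
    (hsep : SeparatesPoints 𝓜) {x y : X} (hxy : x ≠ y) (hns : ¬ Sees 𝓜 sup x y)
    {A B : Set X} (hA : Avoids 𝓜 y A) (hB : Avoids 𝓜 y B) : f y A = f y B := by
  obtain ⟨C, hC, ⟨hxC, hyC⟩ | ⟨hxC, hyC⟩⟩ := hsep x y hxy
  · by_contra hne
    have hA' : f y C = f y A := by
      by_contra hn; exact hns ⟨_, hf.witness_of_ne h hC hxC hyC hA hn⟩
    have hB' : f y C = f y B := by
      by_contra hn; exact hns ⟨_, hf.witness_of_ne h hC hxC hyC hB hn⟩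
    exact hne (hA'.symm.trans hB')
  · exact absurd ⟨C, witness_of_mem hC hyC hxC⟩ hns

theorem side_eq_of_not_sees (h : SetLocLattice 𝓜 sup) (hf : SideColoring 𝓜 sup f)
    (hsep : SeparatesPoints 𝓜) {x y p q : X} (hxy : x ≠ y) (hns : ¬ Sees 𝓜 sup x y)
    (hp : Sees 𝓜 sup y p) (hq : Sees 𝓜 sup y q) :
    side 𝓜 sup f y p = side 𝓜 sup f y q := by
  obtain ⟨W, hW⟩ := hp
  obtain ⟨W', hW'⟩ := hq
  rw [hf.side_eq h hW, hf.side_eq h hW']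
  exact hf.eq_of_not_sees h hsep hxy hns (hW.avoids h) (hW'.avoids h)

/-- Among three points, exactly one has the other two on opposite sides. -/
def OneBetween (s : X → X → Bool) (x y z : X) : Prop :=
  ((s x y ^^ s x z) ^^ ((s y x ^^ s y z) ^^ (s z x ^^ s z y))) = true ∧
    ¬ (s x y ≠ s x z ∧ s y x ≠ s y z ∧ s z x ≠ s z y)

theorem oneBetween_swap {s : X → X → Bool} {x y z : X} (ho : OneBetween s x y z) :
    OneBetween s y x z := by
  unfold OneBetween at *; grind

theorem oneBetween_rotate {s : X → X → Bool} {x y z : X} (ho : OneBetween s x y z) :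
    OneBetween s y z x := by
  unfold OneBetween at *; grind

/-- The case of points `x`, `z` such that `z` is only in sets containing `x`, with a set
separating both from `y`. -/
theorem oneBetween_of_common_witness (h : SetLocLattice 𝓜 sup) (hf : SideColoring 𝓜 sup f)
    {x y z : X} (hzx : ∀ M ∈ 𝓜, z ∈ M → x ∈ M) (hz : Sees 𝓜 sup x z)
    {N B : Set X} (hN : N ∈ 𝓜) (hzN : z ∈ N) (hyN : y ∉ N)
    (hxB : Witness 𝓜 sup x y B) (hzB : Witness 𝓜 sup z y B)
    {A : Set X} (hA : A ∈ 𝓜) (hxA : x ∈ A) (hzA : z ∉ A) :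
    OneBetween (side 𝓜 sup f) x y z := by
  obtain ⟨C, hC⟩ := hz
  have hzC : z ∉ C := fun hzC => hC.2.1 (hzx _ hC.1 hzC)
  have hne := hf.ne_of_witness h hC hzC hA hxA hzA
  have aC : Avoids 𝓜 z C := ⟨hC.1, (hC.avoids h).2.1, hzC⟩
  have key : f x B ≠ f x C ↔ f z B ≠ f z C := by
    rw [hf.ne_iff (hxB.avoids h) (hC.avoids h), hf.ne_iff (hzB.avoids h) aC]
    refine ⟨fun hx => ?_, hzx _ (h.sup_mem _ hxB.1 _ hC.1)⟩
    by_contra hz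
    have hCB : sup C B = sup B C := h.sup_comm hC.1 hxB.1
    refine hne ?_
    rw [← hf.sup_left h aC hxB.1 (hCB ▸ hz), hCB]
    exact hf.eq_of_mem h hA (h.sup_mem _ hxB.1 _ hC.1) hxA hx hzA hz
  unfold OneBetween
  rw [hf.side_eq h hxB, hf.side_eq h hC, hf.side_eq h (witness_of_mem hN (hzx _ hN hzN) hyN),
    hf.side_eq h (witness_of_mem hN hzN hyN), hf.side_eq h (witness_of_mem hA hxA hzA),
    hf.side_eq h hzB]
  revert key hne
  generalize f x B = p, f x C = q, f z A = r, f z B = t, f z C = u, f y N = v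
  revert p q r t u v
  decide

/-- The case of a point `x` contained in all the sets containing `y` or `z`. -/
theorem oneBetween_of_common_lower (h : SetLocLattice 𝓜 sup) (hf : SideColoring 𝓜 sup f)
    {x y z : X} (hzx : ∀ M ∈ 𝓜, z ∈ M → x ∈ M) (hyx : ∀ M ∈ 𝓜, y ∈ M → x ∈ M)
    (hz : Sees 𝓜 sup x z) (hy : Sees 𝓜 sup x y)
    {M N : Set X} (hM : M ∈ 𝓜) (hzM : z ∈ M) (hyM : y ∉ M) (hN : N ∈ 𝓜) (hyN : y ∈ N)
    (hzN : z ∉ N) : OneBetween (side 𝓜 sup f) x y z := by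
  obtain ⟨C, hC⟩ := hz
  obtain ⟨B, hB⟩ := hy
  have hzC : z ∉ C := fun hzC => hC.2.1 (hzx _ hC.1 hzC)
  have hyB : y ∉ B := fun hyB => hB.2.1 (hyx _ hB.1 hyB)
  have aC : Avoids 𝓜 z C := ⟨hC.1, (hC.avoids h).2.1, hzC⟩
  have aB : Avoids 𝓜 y B := ⟨hB.1, (hB.avoids h).2.1, hyB⟩
  have hxM := hzx _ hM hzM
  have hxN := hyx _ hN hyN
  have hEm := h.sup_mem _ hB.1 _ hC.1
  have key : f x B ≠ f x C := by
    rw [hf.ne_iff (hB.avoids h) (hC.avoids h)]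
    by_contra hx
    have hzE : z ∉ sup B C := fun hz => hx (hzx _ hEm hz)
    have hyE : y ∉ sup B C := fun hy => hx (hyx _ hEm hy)
    have e1 : f z (sup B C) = f z C := by
      rw [h.sup_comm hB.1 hC.1] at hzE ⊢
      exact hf.sup_left h aC hB.1 hzE
    have e2 : f y (sup B C) = f y B := hf.sup_left h aB hC.1 hyE
    have hne : (sup B C).Nonempty := (hB.avoids h).2.1.mono (h.subset_sup_left _ hB.1 _ hC.1)
    have n1 := hf.ne_of_witness h hC hzC hN hxN hzN
    have n2 := hf.ne_of_witness h hB hyB hM hxM hyM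
    rw [← e1, hf.ne_iff ⟨hN, ⟨_, hyN⟩, hzN⟩ ⟨hEm, hne, hzE⟩] at n1
    rw [← e2, hf.ne_iff ⟨hM, ⟨_, hzM⟩, hyM⟩ ⟨hEm, hne, hyE⟩] at n2
    exact h.not_mem_sup_and_mem_sup hM hN hEm hzM hyM hyN hzN hzE hyE n1 n2
  unfold OneBetween
  rw [hf.side_eq h hB, hf.side_eq h hC, hf.side_eq h (witness_of_mem hM hxM hyM),
    hf.side_eq h (witness_of_mem hM hzM hyM), hf.side_eq h (witness_of_mem hN hxN hzN),
    hf.side_eq h (witness_of_mem hN hyN hzN)]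
  grind

/-- The case of a point `z` all of whose sets contain `x` and `y`. -/
theorem oneBetween_of_common_upper (h : SetLocLattice 𝓜 sup) (hf : SideColoring 𝓜 sup f)
    {x y z : X} (hzx : ∀ M ∈ 𝓜, z ∈ M → x ∈ M) (hzy : ∀ M ∈ 𝓜, z ∈ M → y ∈ M)
    (hxz : Sees 𝓜 sup x z) {A B : Set X} (hA : A ∈ 𝓜) (hxA : x ∈ A) (hyA : y ∉ A)
    (hB : B ∈ 𝓜) (hyB : y ∈ B) (hxB : x ∉ B) : OneBetween (side 𝓜 sup f) x y z := by
  have hzA : z ∉ A := fun hz => hyA (hzy _ hA hz)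
  have hzB : z ∉ B := fun hz => hxB (hzx _ hB hz)
  have aA : Avoids 𝓜 z A := ⟨hA, ⟨x, hxA⟩, hzA⟩
  have aB : Avoids 𝓜 z B := ⟨hB, ⟨y, hyB⟩, hzB⟩
  unfold OneBetween
  rw [hf.side_eq h (witness_of_mem hA hxA hyA), hf.side_eq h (witness_of_mem hB hyB hxB),
    hf.side_eq h (witness_of_mem hA hxA hzA), hf.side_eq h (witness_of_mem hB hyB hzB)]
  by_cases hAB : f z A = f z B
  · obtain ⟨C, hC⟩ := hxz
    have hzC : z ∉ C := fun hzC => hC.2.1 (hzx _ hC.1 hzC)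
    have hyC : y ∉ C := hf.notMem_of_ne h hB hC.1 hzB hzC
      (hAB ▸ hf.ne_of_witness h hC hzC hA hxA hzA) hyB
    have aC : Avoids 𝓜 z C := ⟨hC.1, (hC.avoids h).2.1, hzC⟩
    have nA := hf.ne_of_witness h hC hzC hA hxA hzA
    have nB : f z B ≠ f z C := hAB ▸ nA
    have hyC' := hf.witness_of_ne h hB hyB hzB aC nB
    rw [hf.side_eq h hC, hf.side_eq h hyC']
    have zAC := (hf.ne_iff aA aC).1 nA
    have zBC := (hf.ne_iff aB aC).1 nB
    have zAB := (hf z A B aA aB).1 hAB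
    have key1 : ¬ (f x B ≠ f x C ∧ f y A ≠ f y C) := by
      rw [hf.ne_iff ⟨hB, ⟨y, hyB⟩, hxB⟩ (hC.avoids h),
        hf.ne_iff ⟨hA, ⟨x, hxA⟩, hyA⟩ (hyC'.avoids h)]
      exact fun hh => h.not_mem_sup_and_mem_sup hA hB hC.1 hxA hyA hyB hxB hC.2.1 hyC hh.1 hh.2
    have key2 : f x B ≠ f x C ∨ f y A ≠ f y C := by
      rw [hf.ne_iff ⟨hB, ⟨y, hyB⟩, hxB⟩ (hC.avoids h),
        hf.ne_iff ⟨hA, ⟨x, hxA⟩, hyA⟩ (hyC'.avoids h)]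
      rcases h.trichotomy _ hA _ hB _ hC.1 with hs | hs | hs
      · exact .inl (hs hxA)
      · exact .inr (hs hyB)
      · exact absurd (h.sup_least _ hA _ hC.1 _ (h.sup_mem _ hA _ hB)
          (h.subset_sup_left _ hA _ hB) hs zAC) zAB
    grind
  · rw [hf.side_eq h (hf.witness_of_ne h hA hxA hzA aB hAB),
      hf.side_eq h (hf.witness_of_ne h hB hyB hzB aA (Ne.symm hAB))]
    grind

/-- The case of three mutually separated points. -/
theorem oneBetween_of_separated (h : SetLocLattice 𝓜 sup) (hf : SideColoring 𝓜 sup f)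
    {x y z : X} {A B C : Set X} (hA : A ∈ 𝓜) (hB : B ∈ 𝓜) (hC : C ∈ 𝓜)
    (hxA : x ∈ A) (hyA : y ∉ A) (hzA : z ∉ A) (hxB : x ∉ B) (hyB : y ∈ B) (hzB : z ∉ B)
    (hxC : x ∉ C) (hyC : y ∉ C) (hzC : z ∈ C) : OneBetween (side 𝓜 sup f) x y z := by
  have aux : ∀ {x y : X} {A : Set X}, A ∈ 𝓜 → x ∈ A → y ∉ A → Avoids 𝓜 y A :=
    fun hA hx hy => ⟨hA, ⟨_, hx⟩, hy⟩
  unfold OneBetween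
  rw [hf.side_eq h (witness_of_mem hA hxA hyA), hf.side_eq h (witness_of_mem hB hyB hxB),
    hf.side_eq h (witness_of_mem hA hxA hzA), hf.side_eq h (witness_of_mem hB hyB hzB),
    hf.side_eq h (witness_of_mem hC hzC hxC), hf.side_eq h (witness_of_mem hC hzC hyC)]
  have kx := hf.ne_iff (aux hB hyB hxB) (aux hC hzC hxC)
  have ky := hf.ne_iff (aux hA hxA hyA) (aux hC hzC hyC)
  have kz := hf.ne_iff (aux hA hxA hzA) (aux hB hyB hzB)
  have eAB := h.sup_comm hA hB
  have eAC := h.sup_comm hA hC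
  have eBC := h.sup_comm hB hC
  have n1 := h.not_mem_sup_and_mem_sup hA hB hC hxA hyA hyB hxB hxC hyC
  have n2 := h.not_mem_sup_and_mem_sup hA hC hB hxA hzA hzC hxC hxB hzB
  have n3 := h.not_mem_sup_and_mem_sup hB hC hA hyB hzB hzC hyC hyA hzA
  rw [← eBC] at n2
  rw [← eAB, ← eAC] at n3
  have ht : x ∈ sup B C ∨ y ∈ sup A C ∨ z ∈ sup A B := by
    rcases h.trichotomy _ hA _ hB _ hC with hs | hs | hs
    · exact .inl (hs hxA)
    · exact .inr (.inl (hs hyB))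
    · exact .inr (.inr (hs hzC))
  rw [← kx, ← ky, ← kz] at ht
  rw [← kx, ← ky] at n1
  rw [← kx, ← kz] at n2
  rw [← ky, ← kz] at n3
  grind

theorem oneBetween_of_forall_mem (h : SetLocLattice 𝓜 sup) (hf : SideColoring 𝓜 sup f)
    (hsep : SeparatesPoints 𝓜) {x y z : X} (hxy : MutuallySee 𝓜 sup x y)
    (hxz : MutuallySee 𝓜 sup x z) (hyz : MutuallySee 𝓜 sup y z)
    (hzx : ∀ M ∈ 𝓜, z ∈ M → x ∈ M) : OneBetween (side 𝓜 sup f) x y z := by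
  obtain ⟨A, hA, hxA, hzA⟩ := exists_separating hsep hxz.1.ne hzx
  by_cases hzy : ∀ M ∈ 𝓜, z ∈ M → y ∈ M
  · by_cases hyx : ∀ M ∈ 𝓜, y ∈ M → x ∈ M
    · obtain ⟨N, hN, hyN, hzN⟩ := exists_separating hsep hyz.1.ne hzy
      obtain ⟨D, hD, hxD, hyD⟩ := exists_separating hsep hxy.1.ne hyx
      obtain ⟨C, hC⟩ := hyz.1
      have hzC : z ∉ C := fun hzC => hC.2.1 (hzy _ hC.1 hzC)
      have hne := hf.ne_of_witness h hC hzC hN hyN hzN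
      have aC : Avoids 𝓜 z C := ⟨hC.1, (hC.avoids h).2.1, hzC⟩
      have := oneBetween_of_common_witness h hf hyx hxy.1 hN hyN hzN
        (hf.witness_of_ne h hN (hyx _ hN hyN) hzN aC hne) hC hD hxD hyD
      exact oneBetween_swap (oneBetween_rotate (oneBetween_rotate this))
    · push Not at hyx
      obtain ⟨B, hB, hyB, hxB⟩ := hyx
      by_cases hxy' : ∀ M ∈ 𝓜, x ∈ M → y ∈ M
      · obtain ⟨C, hC⟩ := hxz.1
        have hzC : z ∉ C := fun hzC => hC.2.1 (hzx _ hC.1 hzC)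
        have hne := hf.ne_of_witness h hC hzC hA hxA hzA
        have aC : Avoids 𝓜 z C := ⟨hC.1, (hC.avoids h).2.1, hzC⟩
        have := oneBetween_of_common_witness h hf hxy' hxy.2 hA hxA hzA
          (hf.witness_of_ne h hA (hxy' _ hA hxA) hzA aC hne) hC hB hyB hxB
        exact oneBetween_rotate (oneBetween_rotate this)
      · push Not at hxy'
        obtain ⟨D, hD, hxD, hyD⟩ := hxy'
        exact oneBetween_of_common_upper h hf hzx hzy hxz.1 hD hxD hyD hB hyB hxB
  · push Not at hzy
    obtain ⟨N, hN, hzN, hyN⟩ := hzy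
    by_cases hyx : ∀ M ∈ 𝓜, y ∈ M → x ∈ M
    · by_cases hyz' : ∀ M ∈ 𝓜, y ∈ M → z ∈ M
      · obtain ⟨C, hC⟩ := hyz.2
        have hyC : y ∉ C := fun hyC => hC.2.1 (hyz' _ hC.1 hyC)
        have hne := hf.ne_of_witness h hC hyC hN hzN hyN
        have aC : Avoids 𝓜 y C := ⟨hC.1, (hC.avoids h).2.1, hyC⟩
        exact oneBetween_of_common_witness h hf hzx hxz.1 hN hzN hyN
          (hf.witness_of_ne h hN (hzx _ hN hzN) hyN aC hne) hC hA hxA hzA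
      · push Not at hyz'
        obtain ⟨M, hM, hyM, hzM⟩ := hyz'
        exact oneBetween_of_common_lower h hf hzx hyx hxz.1 hxy.1 hN hzN hyN hM hyM hzM
    · push Not at hyx
      obtain ⟨B, hB, hyB, hxB⟩ := hyx
      exact oneBetween_of_common_witness h hf hzx hxz.1 hN hzN hyN
        (witness_of_mem hB hyB hxB) (witness_of_mem hB hyB fun hz => hxB (hzx _ hB hz))
        hA hxA hzA

theorem oneBetween (h : SetLocLattice 𝓜 sup) (hf : SideColoring 𝓜 sup f)
    (hsep : SeparatesPoints 𝓜) {x y z : X} (hxy : MutuallySee 𝓜 sup x y)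
    (hxz : MutuallySee 𝓜 sup x z) (hyz : MutuallySee 𝓜 sup y z) :
    OneBetween (side 𝓜 sup f) x y z := by
  by_cases c1 : ∀ M ∈ 𝓜, z ∈ M → x ∈ M
  · exact oneBetween_of_forall_mem h hf hsep hxy hxz hyz c1
  by_cases c2 : ∀ M ∈ 𝓜, x ∈ M → z ∈ M
  · exact oneBetween_rotate (oneBetween_rotate (oneBetween_swap
      (oneBetween_of_forall_mem h hf hsep hyz.symm hxz.symm hxy.symm c2)))
  by_cases c3 : ∀ M ∈ 𝓜, z ∈ M → y ∈ M
  · exact oneBetween_swap (oneBetween_of_forall_mem h hf hsep hxy.symm hyz hxz c3)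
  by_cases c4 : ∀ M ∈ 𝓜, y ∈ M → z ∈ M
  · exact oneBetween_rotate
      (oneBetween_of_forall_mem h hf hsep hxz.symm hyz.symm hxy c4)
  by_cases c5 : ∀ M ∈ 𝓜, y ∈ M → x ∈ M
  · exact oneBetween_swap (oneBetween_rotate (oneBetween_rotate
      (oneBetween_of_forall_mem h hf hsep hxz hxy hyz.symm c5)))
  by_cases c6 : ∀ M ∈ 𝓜, x ∈ M → y ∈ M
  · exact oneBetween_rotate (oneBetween_rotate
      (oneBetween_of_forall_mem h hf hsep hyz hxy.symm hxz.symm c6))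
  push Not at c1 c2 c3 c4 c5 c6
  obtain ⟨C1, hC1, zC1, xC1⟩ := c1
  obtain ⟨A1, hA1, xA1, zA1⟩ := c2
  obtain ⟨C2, hC2, zC2, yC2⟩ := c3
  obtain ⟨B1, hB1, yB1, zB1⟩ := c4
  obtain ⟨B2, hB2, yB2, xB2⟩ := c5
  obtain ⟨A2, hA2, xA2, yA2⟩ := c6
  exact oneBetween_of_separated h hf (h.inter_mem _ hA1 _ hA2) (h.inter_mem _ hB1 _ hB2)
    (h.inter_mem _ hC1 _ hC2) ⟨xA1, xA2⟩ (fun hh => yA2 hh.2) (fun hh => zA1 hh.1)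
    (fun hh => xB2 hh.2) ⟨yB1, yB2⟩ (fun hh => zB1 hh.1) (fun hh => xC1 hh.1)
    (fun hh => yC2 hh.2) ⟨zC1, zC2⟩

theorem exists_mem_of_sees (h : SetLocLattice 𝓜 sup) (hf : SideColoring 𝓜 sup f)
    (hsep : SeparatesPoints 𝓜) {x y v : X} (hxy : x ≠ y) (hns : ¬ Sees 𝓜 sup x y)
    (hv : Sees 𝓜 sup v y) : ∃ W ∈ 𝓜, y ∈ W ∧ v ∉ W := by
  obtain ⟨W, hW⟩ := hv
  by_cases hyW : y ∈ W
  · exact ⟨W, hW.1, hyW, hW.2.1⟩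
  · obtain ⟨-, -, hy | ⟨-, A, hA, hvA, hyA, -⟩⟩ := id hW
    · exact absurd hy hyW
    · exact absurd (hf.eq_of_not_sees h hsep hxy hns ⟨hA, ⟨v, hvA⟩, hyA⟩
        ⟨hW.1, (hW.avoids h).2.1, hyW⟩) (hf.ne_of_witness h hW hyW hA hvA hyA)

theorem not_sees_trans (h : SetLocLattice 𝓜 sup) (hf : SideColoring 𝓜 sup f)
    (hsep : SeparatesPoints 𝓜) {x y z : X} (hxy : x ≠ y) (hyz : y ≠ z)
    (nxy : ¬ Sees 𝓜 sup x y) (nyz : ¬ Sees 𝓜 sup y z) : x ≠ z ∧ ¬ Sees 𝓜 sup x z := by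
  refine ⟨?_, fun hs => ?_⟩
  · rintro rfl
    exact (sees_or_sees_of_ne hsep hxy).elim nxy nyz
  · obtain ⟨W, hW, hzW, hxW⟩ := hf.exists_mem_of_sees h hsep hyz nyz hs
    exact hxW (mem_of_not_sees nxy hW (mem_of_not_sees nyz hW hzW))

/-- A point that does not see `y` is on the same side as `y` of any point seeing `y`. -/
theorem side_eq_side_of_not_sees (h : SetLocLattice 𝓜 sup) (hf : SideColoring 𝓜 sup f)
    (hsep : SeparatesPoints 𝓜) {x y v : X} (hxy : x ≠ y) (hns : ¬ Sees 𝓜 sup x y)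
    (hv : Sees 𝓜 sup v y) : side 𝓜 sup f v x = side 𝓜 sup f v y := by
  obtain ⟨W, hW, hyW, hvW⟩ := hf.exists_mem_of_sees h hsep hxy hns hv
  rw [hf.side_eq h (witness_of_mem hW hyW hvW),
    hf.side_eq h (witness_of_mem hW (mem_of_not_sees hns hW hyW) hvW)]

theorem exists_orientation (h : SetLocLattice 𝓜 sup) (hf : SideColoring 𝓜 sup f)
    (hsep : SeparatesPoints 𝓜) : ∃ σ, Orients 𝓜 sup f σ := by
  have hirr : ∀ x, ¬ MutuallySee 𝓜 sup x x := fun x hx => hx.1.ne rfl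
  have hsymm : ∀ x y, MutuallySee 𝓜 sup x y → MutuallySee 𝓜 sup y x := fun x y hs => hs.symm
  let s := side 𝓜 sup f
  let c : X → X → Bool := fun x y => !(s x y ^^ s y x)
  have hc : ∀ x y, c x y = c y x := fun x y => by simp only [c, Bool.xor_comm]
  obtain ⟨σ, hσ⟩ := exists_switching hirr hsymm hc <|
    signedCover_not_reachable_flip (lt := fun x y => x ≠ y ∧ ¬ Sees 𝓜 sup x y)
      (fun x y z hxy hyz => hf.not_sees_trans h hsep hxy.1 hyz.1 hxy.2 hyz.2)
      (fun x hx => hx.1 rfl)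
      (fun x y => by have := Sees.ne (𝓜 := 𝓜) (sup := sup) (x := x) (y := y)
                     unfold MutuallySee; grind)
      (fun x y hs hl => hl.2 hs.1)
      (fun x y z hxy hyz hxz => by
        have := (hf.oneBetween h hsep hxy hxz hyz).1
        simp only [c]
        change ((s x y ^^ s x z) ^^ ((s y x ^^ s y z) ^^ (s z x ^^ s z y))) = true at this
        revert this
        generalize s x y = a1, s x z = a2, s y x = a3, s y z = a4, s z x = a5, s z y = a6
        revert a1 a2 a3 a4 a5 a6
        decide)
      (fun x y z w hxz hyw hxy hyz hzw hxw => by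
        have e1 : s z y = s z w := hf.side_eq_of_not_sees h hsep hxz.1 hxz.2 hyz.2 hzw.1
        have e2 : s w z = s w x := hf.side_eq_of_not_sees h hsep hyw.1 hyw.2 hzw.2 hxw.2
        have e3 : s x y = s x w := hf.side_eq_side_of_not_sees h hsep hyw.1 hyw.2 hxw.1
        have e4 : s y x = s y z := hf.side_eq_side_of_not_sees h hsep hxz.1 hxz.2 hyz.1
        simp only [c, e1, e2, e3, e4]
        generalize s x w = a1, s y z = a2, s z w = a3, s w x = a4
        revert a1 a2 a3 a4
        decide)
  refine ⟨σ, fun x y hs => ?_⟩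
  have := hσ x y hs
  simp only [c] at this
  change (σ x ^^ s x y) ≠ (σ y ^^ s y x)
  revert this
  generalize σ x = a1, σ y = a2, s x y = a3, s y x = a4
  revert a1 a2 a3 a4
  decide

end SideColoring

/-- `x` is on the left of `y`, where `σ` tells which label stands for the left side. -/
def Precedes (𝓜 : Set (Set X)) (sup : Set X → Set X → Set X) (f : X → Set X → Bool)
    (σ : X → Bool) (x y : X) : Prop :=
  (Sees 𝓜 sup y x ∧ (σ y ^^ side 𝓜 sup f y x) = true) ∨
    (Sees 𝓜 sup x y ∧ (σ x ^^ side 𝓜 sup f x y) = false)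

namespace Precedes

variable {σ : X → Bool}

theorem iff_left (hσ : Orients 𝓜 sup f σ) {x y : X}
    (hs : Sees 𝓜 sup y x) :
    Precedes 𝓜 sup f σ x y ↔ (σ y ^^ side 𝓜 sup f y x) = true := by
  have := hσ x y
  unfold MutuallySee at this
  unfold Precedes
  grind

theorem iff_right (hσ : Orients 𝓜 sup f σ) {x y : X}
    (hs : Sees 𝓜 sup x y) :
    Precedes 𝓜 sup f σ x y ↔ (σ x ^^ side 𝓜 sup f x y) = false := by
  have := hσ x y
  unfold MutuallySee at this
  unfold Precedes
  grind

theorem total (hsep : SeparatesPoints 𝓜) {x y : X} (hxy : x ≠ y) :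
    Precedes 𝓜 sup f σ x y ∨ Precedes 𝓜 sup f σ y x := by
  have := sees_or_sees_of_ne (sup := sup) hsep hxy
  unfold Precedes
  cases h1 : (σ y ^^ side 𝓜 sup f y x) <;> cases h2 : (σ x ^^ side 𝓜 sup f x y) <;> tauto

theorem sees_or_sees {x y : X} (hxy : Precedes 𝓜 sup f σ x y) :
    Sees 𝓜 sup x y ∨ Sees 𝓜 sup y x :=
  hxy.elim (fun hh => .inr hh.1) (fun hh => .inl hh.1)

theorem ne {x y : X} (hxy : Precedes 𝓜 sup f σ x y) : x ≠ y :=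
  hxy.sees_or_sees.elim Sees.ne fun hh => hh.ne.symm

theorem asymm (hσ : Orients 𝓜 sup f σ) {x y : X}
    (hxy : Precedes 𝓜 sup f σ x y) : ¬ Precedes 𝓜 sup f σ y x := by
  intro hyx
  rcases hxy.sees_or_sees with hs | hs
  · rw [iff_right hσ hs] at hxy
    rw [iff_left hσ hs, hxy] at hyx
    cases hyx
  · rw [iff_left hσ hs] at hxy
    rw [iff_right hσ hs, hxy] at hyx
    cases hyx

theorem side_ne (hσ : Orients 𝓜 sup f σ) {x y z : X}
    (hxy : Precedes 𝓜 sup f σ x y) (hyz : Precedes 𝓜 sup f σ y z) (hx : Sees 𝓜 sup y x)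
    (hz : Sees 𝓜 sup y z) : side 𝓜 sup f y x ≠ side 𝓜 sup f y z := by
  rw [iff_left hσ hx] at hxy
  rw [iff_right hσ hz] at hyz
  intro he
  rw [he, hyz] at hxy
  cases hxy

theorem sees_of_side_ne (h : SetLocLattice 𝓜 sup) (hf : SideColoring 𝓜 sup f)
    (hsep : SeparatesPoints 𝓜) {x y z : X} (hxy : x ≠ y) (hyz : y ≠ z) (hxz : x ≠ z)
    (hy : Sees 𝓜 sup y x → Sees 𝓜 sup y z → side 𝓜 sup f y x ≠ side 𝓜 sup f y z)
    (hz : Sees 𝓜 sup z x → Sees 𝓜 sup z y → side 𝓜 sup f z x ≠ side 𝓜 sup f z y) :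
    Sees 𝓜 sup x z := by
  by_contra hns
  have hzx := (sees_or_sees_of_ne hsep hxz).resolve_left hns
  by_cases hzy : Sees 𝓜 sup z y
  · exact hz hzx hzy (hf.side_eq_of_not_sees h hsep hxz hns hzx hzy)
  · have nxy := (hf.not_sees_trans h hsep hxz hyz.symm hns hzy).2
    have hyx := (sees_or_sees_of_ne hsep hxy).resolve_left nxy
    have hyz' := (sees_or_sees_of_ne hsep hyz).resolve_right hzy
    exact hy hyx hyz' (hf.side_eq_of_not_sees h hsep hxy nxy hyx hyz')

theorem trans (h : SetLocLattice 𝓜 sup) (hf : SideColoring 𝓜 sup f)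
    (hsep : SeparatesPoints 𝓜) (hσ : Orients 𝓜 sup f σ) {x y z : X}
    (hxy : Precedes 𝓜 sup f σ x y) (hyz : Precedes 𝓜 sup f σ y z) :
    Precedes 𝓜 sup f σ x z := by
  have hxz : x ≠ z := fun he => hxy.asymm hσ (he ▸ hyz)
  by_contra hn
  have hzx := (total hsep hxz).resolve_left hn
  have ny := side_ne hσ hxy hyz
  have nz := side_ne hσ hyz hzx
  have nx := side_ne hσ hzx hxy
  have ny' := fun a b => (ny b a).symm
  have nz' := fun a b => (nz b a).symm
  have nx' := fun a b => (nx b a).symm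
  have hxy' := hxy.ne
  have hyz' := hyz.ne
  have s1 : MutuallySee 𝓜 sup x y :=
    ⟨sees_of_side_ne h hf hsep hxz hyz'.symm hxy' nz' ny,
      sees_of_side_ne h hf hsep hyz' hxz.symm hxy'.symm nz nx'⟩
  have s2 : MutuallySee 𝓜 sup x z :=
    ⟨sees_of_side_ne h hf hsep hxy' hyz' hxz ny nz',
      sees_of_side_ne h hf hsep hyz'.symm hxy'.symm hxz.symm ny' nx⟩
  have s3 : MutuallySee 𝓜 sup y z :=
    ⟨sees_of_side_ne h hf hsep hxy'.symm hxz hyz' nx' nz,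
      sees_of_side_ne h hf hsep hxz.symm hxy' hyz'.symm nx ny'⟩
  exact (hf.oneBetween h hsep s1 s2 s3).2
    ⟨nx' s1.1 s2.1, ny s1.2 s3.1, nz' s2.2 s3.2⟩

theorem mem_of_mem (h : SetLocLattice 𝓜 sup) (hf : SideColoring 𝓜 sup f)
    (hσ : Orients 𝓜 sup f σ) {a b c : X} {M : Set X}
    (hM : M ∈ 𝓜) (ha : a ∈ M) (hc : c ∈ M) (hab : Precedes 𝓜 sup f σ a b)
    (hbc : Precedes 𝓜 sup f σ b c) : b ∈ M := by
  by_contra hb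
  have wa : Witness 𝓜 sup b a M := witness_of_mem hM ha hb
  have wc : Witness 𝓜 sup b c M := witness_of_mem hM hc hb
  exact side_ne hσ hab hbc ⟨_, wa⟩ ⟨_, wc⟩ (by rw [hf.side_eq h wa, hf.side_eq h wc])

theorem of_side_ne (hσ : Orients 𝓜 sup f σ) {x y z : X}
    (hx : Sees 𝓜 sup y x) (hz : Sees 𝓜 sup y z)
    (hne : side 𝓜 sup f y x ≠ side 𝓜 sup f y z) :
    Precedes 𝓜 sup f σ x y ∧ Precedes 𝓜 sup f σ y z ∨
      Precedes 𝓜 sup f σ z y ∧ Precedes 𝓜 sup f σ y x := by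
  rw [iff_left hσ hx, iff_right hσ hz, iff_left hσ hz, iff_right hσ hx]
  revert hne
  generalize σ y = p, side 𝓜 sup f y x = q, side 𝓜 sup f y z = r
  revert p q r
  decide

end Precedes

end Sides

theorem loc_lattice_of_sets_well_sep_orderable {X : Type u} (𝓜 : Set (Set X))
    (sup : Set X → Set X → Set X) (h : SetLocLattice 𝓜 sup)
    (hsep : WellSeparates 𝓜) :
    ∃ le : X → X → Prop, IsLinearOrder X le ∧
      (∀ M ∈ 𝓜, RelConvex le M) ∧
      ∀ A ∈ 𝓜, ∀ B ∈ 𝓜, A ∪ B ⊆ sup A B ∧ RelConvex le (sup A B) ∧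
        ∀ S : Set X, RelConvex le S → A ∪ B ⊆ S → sup A B ⊆ S := by
  obtain ⟨f, hf⟩ := h.exists_sideColoring
  obtain ⟨σ, hσ⟩ := hf.exists_orientation h hsep.1
  let le : X → X → Prop := fun x y => x = y ∨ Precedes 𝓜 sup f σ x y
  have hconv : ∀ M ∈ 𝓜, RelConvex le M := by
    rintro M hM a b c ha hc (rfl | hab) (rfl | hbc)
    · exact ha
    · exact ha
    · exact hc
    · exact Precedes.mem_of_mem h hf hσ hM ha hc hab hbc
  refine ⟨le, ?_, hconv, fun A hA B hB => ⟨?_, hconv _ (h.sup_mem _ hA _ hB), ?_⟩⟩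
  · refine { refl := fun x => .inl rfl, trans := ?_, antisymm := ?_, total := ?_ }
    · rintro a b c (rfl | hab) (rfl | hbc)
      · exact .inl rfl
      · exact .inr hbc
      · exact .inr hab
      · exact .inr (hab.trans h hf hsep.1 hσ hbc)
    · rintro a b (rfl | hab) (hba | hba)
      · rfl
      · rfl
      · exact hba.symm
      · exact absurd hba (hab.asymm hσ)
    · intro a b
      by_cases hab : a = b
      · exact .inl (.inl hab)
      · exact (Precedes.total hsep.1 hab).imp .inr .inr
  · exact Set.union_subset (h.subset_sup_left _ hA _ hB) (h.subset_sup_right _ hA _ hB)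
  · intro S hS hABS y hy
    by_cases hyA : y ∈ A
    · exact hABS (.inl hyA)
    by_cases hyB : y ∈ B
    · exact hABS (.inr hyB)
    obtain ⟨hAB, hBA⟩ := h.incomparable_of_mem_sup hA hB hyA hyB hy
    obtain ⟨a, ha, -⟩ := Set.not_subset.1 hAB
    obtain ⟨b, hb, -⟩ := Set.not_subset.1 hBA
    have wa : Witness 𝓜 sup y a A := witness_of_mem hA ha hyA
    have wb : Witness 𝓜 sup y b B := witness_of_mem hB hb hyB
    have hne : side 𝓜 sup f y a ≠ side 𝓜 sup f y b := by
      rw [hf.side_eq h wa, hf.side_eq h wb]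
      exact (hf.ne_iff (wa.avoids h) (wb.avoids h)).2 hy
    rcases Precedes.of_side_ne hσ ⟨_, wa⟩ ⟨_, wb⟩ hne with ⟨h1, h2⟩ | ⟨h1, h2⟩
    · exact hS a y b (hABS (.inl ha)) (hABS (.inr hb)) (.inr h1) (.inr h2)
    · exact hS b y a (hABS (.inr hb)) (hABS (.inl ha)) (.inr h1) (.inr h2)
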